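/- arXiv:1709.06730 — 3 statements merged into one kernel-verified Lean document; each statement's English description precedes it below -/
import Mathlib

section
/- Let S ⊂ ℝⁿ be a nonempty closed convex set containing the origin. Let ρ^ν ∈ [0,∞) and q^ν ∈ ℕ be sequences tending to ∞. Then the union ∪_{ν∈ℕ} pa-fcns^{q^ν}_{ρ^ν}(S) is hypo-dense in usc-fcns(S): for every f ∈ usc-fcns(S) there exists a sequence f^ν with f^ν ∈ pa-fcns^{q^ν}_{ρ^ν}(S) for each ν that hypo-converges to f. -/
open Filter Topology MeasureTheory Metric Set
open scoped Classical ENNReal NNReal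

noncomputable section

variable {n : ℕ}

/-- The hypograph of `f : S → [-∞,∞]`, a subset of `S × ℝ`. -/
def hypo {S : Set (Fin n → ℝ)} (f : S → EReal) : Set (S × ℝ) :=
  {p | (p.2 : EReal) ≤ f p.1}

/-- The space of upper semicontinuous functions on `S`: those whose hypograph is
nonempty and closed in `S × ℝ` (sup-norm metric). -/
def UscFcns (S : Set (Fin n → ℝ)) : Set (S → EReal) :=
  {f | (hypo f).Nonempty ∧ IsClosed (hypo f)}

/-- Hypo-convergence of a sequence of functions on `S`. -/
def HypoConverges {S : Set (Fin n → ℝ)} (fseq : ℕ → S → EReal) (f : S → EReal) : Prop :=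
  (∀ (x : S) (xseq : ℕ → S), Tendsto xseq atTop (𝓝 x) →
     Filter.limsup (fun ν => fseq ν (xseq ν)) atTop ≤ f x) ∧
  (∀ x : S, ∃ xseq : ℕ → S, Tendsto xseq atTop (𝓝 x) ∧
     f x ≤ Filter.liminf (fun ν => fseq ν (xseq ν)) atTop)

/-- Piecewise affine functions of difference-of-max type: on `S ∩ ρ𝔹∞` equal to a
difference of maxima of `q` affine functions, `-∞` elsewhere. -/
def PaFcns (S : Set (Fin n → ℝ)) (q : ℕ) (ρ : ℝ) : Set (S → EReal) :=
  {f | ∃ (a b : Fin q → Fin n → ℝ) (α β : Fin q → ℝ), ∀ x : S,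
      (‖(x : Fin n → ℝ)‖ ≤ ρ →
        f x = (((⨆ k : Fin q, ((∑ i, a k i * (x : Fin n → ℝ) i) + α k)) -
                (⨆ k : Fin q, ((∑ i, b k i * (x : Fin n → ℝ) i) + β k)) : ℝ) : EReal)) ∧
      (¬ ‖(x : Fin n → ℝ)‖ ≤ ρ → f x = ⊥)}

/-- ρ-Attouch-Wets distance between hypographs. -/
def awDistRho {S : Set (Fin n → ℝ)} (f g : S → EReal) (ρ : ℝ) : ℝ :=
  sSup ((fun z : S × ℝ => |infDist z (hypo f) - infDist z (hypo g)|) ''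
    {z : S × ℝ | ‖(z.1 : Fin n → ℝ)‖ ≤ ρ ∧ |z.2| ≤ ρ})

/-- The Attouch-Wets distance. -/
def awDist {S : Set (Fin n → ℝ)} (f g : S → EReal) : ℝ :=
  ∫ ρ in Set.Ioi (0 : ℝ), awDistRho f g ρ * Real.exp (-ρ)

/-- The auxiliary quantity `d̂l_ρ`. -/
def dlHat {S : Set (Fin n → ℝ)} (f g : S → EReal) (ρ : ℝ) : ℝ :=
  sInf {τ : ℝ | 0 ≤ τ ∧
    (∀ x : S, ‖(x : Fin n → ℝ)‖ ≤ ρ → ((-ρ : ℝ) : EReal) ≤ f x →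
        min (f x) ((ρ : ℝ) : EReal) + ((τ : ℝ) : EReal) ≤
          ⨆ y : S, ⨆ (_ : dist y x ≤ τ), g y) ∧
    (∀ x : S, ‖(x : Fin n → ℝ)‖ ≤ ρ → ((-ρ : ℝ) : EReal) ≤ g x →
        min (g x) ((ρ : ℝ) : EReal) + ((τ : ℝ) : EReal) ≤
          ⨆ y : S, ⨆ (_ : dist y x ≤ τ), f y)}

/-- `ε`-argmin of `φ` over `D` (with the paper's conventions automatic in `EReal`). -/
def eArgmin {S : Set (Fin n → ℝ)} (D : Set (S → EReal)) (φ : (S → EReal) → EReal) (ε : ℝ) :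
    Set (S → EReal) :=
  {f ∈ D | φ f ≤ sInf (φ '' D) + (ε : EReal)}

/-- `F` is closed in the metric space `(usc-fcns(S), dl)`. -/
def AwClosed (S : Set (Fin n → ℝ)) (F : Set (S → EReal)) : Prop :=
  ∀ f ∈ UscFcns S, (∀ ε : ℝ, 0 < ε → ∃ g ∈ F, awDist f g < ε) → f ∈ F

/-- `F` is bounded in `(usc-fcns(S), dl)`, i.e. contained in some dl-ball. -/
def AwBounded {S : Set (Fin n → ℝ)} (F : Set (S → EReal)) : Prop :=
  ∃ (g : S → EReal) (r : ℝ), ∀ f ∈ F, awDist g f ≤ r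

/-- Lower semicontinuity of `φ` on `D` with respect to the Attouch-Wets distance. -/
def AwLscOn {S : Set (Fin n → ℝ)} (D : Set (S → EReal)) (φ : (S → EReal) → EReal) : Prop :=
  ∀ f ∈ D, ∀ fseq : ℕ → (S → EReal), (∀ k, fseq k ∈ D) →
    Tendsto (fun k => awDist (fseq k) f) atTop (𝓝 (0 : ℝ)) →
    φ f ≤ Filter.liminf (fun k => φ (fseq k)) atTop

/-- Continuity of `φ` on `D` with respect to the Attouch-Wets distance. -/
def AwContinuousOn {S : Set (Fin n → ℝ)} (D : Set (S → EReal)) (φ : (S → EReal) → EReal) : Prop :=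
  ∀ f ∈ D, ∀ fseq : ℕ → (S → EReal), (∀ k, fseq k ∈ D) →
    Tendsto (fun k => awDist (fseq k) f) atTop (𝓝 (0 : ℝ)) →
    Tendsto (fun k => φ (fseq k)) atTop (𝓝 (φ f))

/-- The outer limit of a sequence of subsets of `(usc-fcns(S), dl)`. -/
def awOutLim {S : Set (Fin n → ℝ)} (A : ℕ → Set (S → EReal)) : Set (S → EReal) :=
  {f | ∃ idx : ℕ → ℕ, StrictMono idx ∧ ∃ a : ℕ → (S → EReal), (∀ k, a k ∈ A (idx k)) ∧
       Tendsto (fun k => awDist (a k) f) atTop (𝓝 (0 : ℝ))}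

/-- Excess of `A` over `B` in `(usc-fcns(S), dl)`. -/
def exs {S : Set (Fin n → ℝ)} (A B : Set (S → EReal)) : EReal :=
  if A = ∅ then 0 else if B = ∅ then ⊤
  else ⨆ f ∈ A, ⨅ g ∈ B, ((awDist f g : ℝ) : EReal)

/-- Pompeiu-Hausdorff distance in `(usc-fcns(S), dl)`. -/
def awHausdorff {S : Set (Fin n → ℝ)} (A B : Set (S → EReal)) : EReal :=
  max (exs A B) (exs B A)

/-- The Borel σ-algebra of `(usc-fcns(S), dl)`, generated by the dl-balls. -/
def awMS (S : Set (Fin n → ℝ)) : MeasurableSpace (S → EReal) :=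
  MeasurableSpace.generateFrom
    {B : Set (S → EReal) | ∃ (f : S → EReal) (r : ℝ), B = {g : S → EReal | awDist f g < r}}

/-- The positive part of an extended real, as an element of `ℝ≥0∞`. -/
def erealPos (x : EReal) : ℝ≥0∞ := if x = ⊤ then ⊤ else ENNReal.ofReal x.toReal

/-- The expectation `∫ h dP = ∫ max(0,h) dP - ∫ max(0,-h) dP`, with `∞ - ∞ = ∞`. -/
def eExp {Ξ : Type*} [MeasurableSpace Ξ] (P : Measure Ξ) (h : Ξ → EReal) : EReal :=
  if (∫⁻ ξ, erealPos (h ξ) ∂P) = ⊤ then ⊤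
  else if (∫⁻ ξ, erealPos (-(h ξ)) ∂P) = ⊤ then ⊥
  else ((((∫⁻ ξ, erealPos (h ξ) ∂P).toReal - (∫⁻ ξ, erealPos (-(h ξ)) ∂P).toReal : ℝ)) : EReal)

/-- A random lower semicontinuous function on `Ξ × F`. -/
def RandomLscFn {Ξ : Type*} (mΞ : MeasurableSpace Ξ) {S : Set (Fin n → ℝ)}
    (F : Set (S → EReal)) (ψ : Ξ → (S → EReal) → EReal) : Prop :=
  (∀ ξ : Ξ, AwLscOn F (ψ ξ)) ∧
  @Measurable (Ξ × F) EReal (mΞ.prod ((awMS S).comap Subtype.val)) inferInstance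
    (fun p => ψ p.1 p.2.1)

/-- Local inf-integrability of a random lsc function. -/
def LocInfIntegrable {Ξ : Type*} [MeasurableSpace Ξ] (P : Measure Ξ) {S : Set (Fin n → ℝ)}
    (F : Set (S → EReal)) (ψ : Ξ → (S → EReal) → EReal) : Prop :=
  ∀ f ∈ F, ∃ ρ : ℝ, 0 < ρ ∧
    ⊥ < eExp P (fun ξ => sInf ((fun g => ψ ξ g) '' {g ∈ F | awDist g f ≤ ρ}))

/-- `Y` is sub-exponential under `P`: a.s. finite and, for some `λ ≥ 0`,
`E[exp(τ(Y - E Y))] ≤ exp(τ²λ²/2)` whenever `|τ| ≤ 1/λ`. -/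
def SubExponential {Ξ : Type*} [MeasurableSpace Ξ] (P : Measure Ξ) (Y : Ξ → EReal) : Prop :=
  (∀ᵐ ξ ∂P, Y ξ ≠ ⊤ ∧ Y ξ ≠ ⊥) ∧
  ∃ l : ℝ, 0 ≤ l ∧ ∀ τ : ℝ, |τ| * l ≤ 1 →
    (∫ ξ, Real.exp (τ * ((Y ξ).toReal - ∫ ξ', (Y ξ').toReal ∂P)) ∂P) ≤
      Real.exp (τ ^ 2 * l ^ 2 / 2)

/-- Sample average `(1/ν) ∑_{j=1}^ν ψ(ξ^j, f)`. -/
def sampleAvg {Ξ : Type*} {S : Set (Fin n → ℝ)} (ψ : Ξ → (S → EReal) → EReal)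
    (ν : ℕ) (ω : Fin ν → Ξ) (f : S → EReal) : EReal :=
  (((1 : ℝ) / ν : ℝ) : EReal) * ∑ j : Fin ν, ψ (ω j) f

/-- `g` is a finite maximum of affine functions. -/
def IsMaxAffine (g : (Fin n → ℝ) → ℝ) : Prop :=
  ∃ s : Finset ((Fin n → ℝ) × ℝ), ∀ x,
    IsGreatest ((fun p : (Fin n → ℝ) × ℝ => (∑ i, p.1 i * x i) + p.2) '' s) (g x)

namespace IsMaxAffine

lemma affine (a : Fin n → ℝ) (α : ℝ) :
    IsMaxAffine (fun x : Fin n → ℝ => (∑ i, a i * x i) + α) :=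
  ⟨{(a, α)}, fun x => by simp⟩

lemma sup {g h : (Fin n → ℝ) → ℝ} (hg : IsMaxAffine g) (hh : IsMaxAffine h) :
    IsMaxAffine (g ⊔ h) := by
  obtain ⟨s, hs⟩ := hg
  obtain ⟨t, ht⟩ := hh
  refine ⟨s ∪ t, fun x => ?_⟩
  rw [Finset.coe_union, Set.image_union]
  exact (hs x).union (ht x)

open scoped Pointwise in
lemma add {g h : (Fin n → ℝ) → ℝ} (hg : IsMaxAffine g) (hh : IsMaxAffine h) :
    IsMaxAffine (g + h) := by
  obtain ⟨s, hs⟩ := hg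
  obtain ⟨t, ht⟩ := hh
  have eval_add (p r : (Fin n → ℝ) × ℝ) (x : Fin n → ℝ) :
      (∑ i, (p + r).1 i * x i) + (p + r).2 =
        ((∑ i, p.1 i * x i) + p.2) + ((∑ i, r.1 i * x i) + r.2) := by
    simp only [Prod.fst_add, Prod.snd_add, Pi.add_apply, add_mul, Finset.sum_add_distrib]
    ring
  refine ⟨s + t, fun x => ⟨?_, ?_⟩⟩
  · obtain ⟨p, hp, hpx⟩ := (hs x).1
    obtain ⟨r, hr, hrx⟩ := (ht x).1
    refine ⟨p + r, Finset.mem_coe.2 (Finset.add_mem_add hp hr), ?_⟩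
    simp only at hpx hrx
    simp only [eval_add, hpx, hrx, Pi.add_apply]
  · rintro _ ⟨_, hpr, rfl⟩
    obtain ⟨p, hp, r, hr, rfl⟩ := Finset.mem_add.1 (Finset.mem_coe.1 hpr)
    simp only [eval_add, Pi.add_apply]
    exact add_le_add ((hs x).2 ⟨p, hp, rfl⟩) ((ht x).2 ⟨r, hr, rfl⟩)

lemma const (c : ℝ) : IsMaxAffine (fun _ : Fin n → ℝ => c) := by
  simpa using affine (0 : Fin n → ℝ) c

lemma abs_coord (K : ℝ) (y : Fin n → ℝ) (i : Fin n) (hK : 0 ≤ K) :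
    IsMaxAffine (fun x : Fin n → ℝ => K * |x i - y i|) := by
  convert (affine (Pi.single i K) (-(K * y i))).sup (affine (Pi.single i (-K)) (K * y i)) using 1
  ext x
  simp only [Pi.sup_apply, Pi.single_apply, ite_mul, zero_mul, Finset.sum_ite_eq',
    Finset.mem_univ, if_true]
  rw [← abs_of_nonneg hK, ← abs_mul, abs_of_nonneg hK, abs_eq_max_neg]
  congr 1 <;> ring

lemma sum {ι : Type*} (s : Finset ι) (g : ι → (Fin n → ℝ) → ℝ)
    (hg : ∀ i ∈ s, IsMaxAffine (g i)) : IsMaxAffine (∑ i ∈ s, g i) :=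
  Finset.sum_induction g IsMaxAffine (fun _ _ => add) (const 0) hg

/-- A finite maximum of affine functions can be padded to any larger number of pieces. -/
lemma exists_ciSup {g : (Fin n → ℝ) → ℝ} (hg : IsMaxAffine g) :
    ∃ Q : ℕ, ∀ q ≥ Q, ∃ (a : Fin q → Fin n → ℝ) (α : Fin q → ℝ), ∀ x,
      g x = ⨆ k : Fin q, ((∑ i, a k i * x i) + α k) := by
  obtain ⟨s, hs⟩ := hg
  refine ⟨s.card, fun q hq => ?_⟩
  have hne : Nonempty s := by
    obtain ⟨p, hp, -⟩ := (hs 0).1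
    exact ⟨⟨p, hp⟩⟩
  obtain ⟨e⟩ : Nonempty (s ↪ Fin q) := by
    apply Function.Embedding.nonempty_of_card_le
    simpa using hq
  have he : Function.Surjective (Function.invFun e) := Function.invFun_surjective e.injective
  refine ⟨fun k => (Function.invFun e k).1.1, fun k => (Function.invFun e k).1.2, fun x => ?_⟩
  rw [← (hs x).csSup_eq, iSup]
  congr 1
  ext r
  constructor
  · rintro ⟨p, hp, rfl⟩
    obtain ⟨k, hk⟩ := he ⟨p, hp⟩
    exact ⟨k, by simp [hk]⟩
  · rintro ⟨k, rfl⟩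
    exact ⟨(Function.invFun e k).1, (Function.invFun e k).2, rfl⟩

end IsMaxAffine

/-- `g` is a difference of two finite maxima of affine functions. -/
def IsDiffMaxAffine (g : (Fin n → ℝ) → ℝ) : Prop :=
  ∃ u v : (Fin n → ℝ) → ℝ, IsMaxAffine u ∧ IsMaxAffine v ∧ g = u - v

namespace IsDiffMaxAffine

lemma sup {g h : (Fin n → ℝ) → ℝ} (hg : IsDiffMaxAffine g) (hh : IsDiffMaxAffine h) :
    IsDiffMaxAffine (g ⊔ h) := by
  obtain ⟨u, v, hu, hv, rfl⟩ := hg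
  obtain ⟨u', v', hu', hv', rfl⟩ := hh
  refine ⟨(u + v') ⊔ (u' + v), v + v', (hu.add hv').sup (hu'.add hv), hv.add hv', ?_⟩
  ext x
  simp only [Pi.sup_apply, Pi.sub_apply, Pi.add_apply]
  rw [← max_sub_sub_right]
  congr 1 <;> ring

lemma cone (c K : ℝ) (y : Fin n → ℝ) (hK : 0 ≤ K) :
    IsDiffMaxAffine (fun x : Fin n → ℝ => c - K * ∑ i, |x i - y i|) := by
  refine ⟨fun _ => c, ∑ i, fun x : Fin n → ℝ => K * |x i - y i|, .const c,
    .sum _ _ fun i _ => .abs_coord K y i hK, ?_⟩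
  ext x
  simp [Finset.mul_sum]

end IsDiffMaxAffine

lemma const_mem_paFcns (S : Set (Fin n → ℝ)) {q : ℕ} (hq : 1 ≤ q) (ρ : ℝ) :
    (fun x : S => if ‖(x : Fin n → ℝ)‖ ≤ ρ then (0 : EReal) else ⊥) ∈ PaFcns S q ρ := by
  have : Nonempty (Fin q) := ⟨⟨0, hq⟩⟩
  refine ⟨0, 0, 0, 0, fun x => ⟨fun h => ?_, fun h => ?_⟩⟩ <;> simp [h]

lemma IsDiffMaxAffine.exists_mem_paFcns {g : (Fin n → ℝ) → ℝ} (hg : IsDiffMaxAffine g)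
    (S : Set (Fin n → ℝ)) :
    ∃ Q : ℕ, ∀ q ≥ Q, ∀ ρ : ℝ,
      (fun x : S => if ‖(x : Fin n → ℝ)‖ ≤ ρ then (g x : EReal) else ⊥) ∈ PaFcns S q ρ := by
  obtain ⟨u, v, hu, hv, rfl⟩ := hg
  obtain ⟨Q, hQ⟩ := hu.exists_ciSup
  obtain ⟨Q', hQ'⟩ := hv.exists_ciSup
  refine ⟨max Q Q', fun q hq ρ => ?_⟩
  obtain ⟨a, α, ha⟩ := hQ q (le_of_max_le_left hq)
  obtain ⟨b, β, hb⟩ := hQ' q (le_of_max_le_right hq)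
  refine ⟨a, b, α, β, fun x => ⟨fun h => ?_, fun h => ?_⟩⟩
  · simp only [h, if_true, Pi.sub_apply, ha, hb]
  · simp [h]

/-- If each property `P m` holds eventually, then `P (m ν) ν` holds eventually for some slowly
growing sequence `m`. -/
lemma exists_tendsto_eventually_diag {P : ℕ → ℕ → Prop} (hP : ∀ m, ∀ᶠ ν in atTop, P m ν) :
    ∃ m : ℕ → ℕ, Tendsto m atTop atTop ∧ ∀ᶠ ν in atTop, P (m ν) ν := by
  simp only [eventually_atTop] at hP
  choose N hN using hP
  refine ⟨fun ν => Nat.findGreatest (fun m => N m ≤ ν) ν, ?_, ?_⟩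
  · refine tendsto_atTop.2 fun m => ?_
    filter_upwards [eventually_ge_atTop (max m (N m))] with ν hν
    exact Nat.le_findGreatest (le_of_max_le_left hν) (le_of_max_le_right hν)
  · filter_upwards [eventually_ge_atTop (N 0)] with ν hν
    exact hN _ _ (Nat.findGreatest_spec (P := fun m => N m ≤ ν) (Nat.zero_le ν) hν)

lemma hypoConverges_of_eventually {S : Set (Fin n → ℝ)} {fseq : ℕ → S → EReal} {f : S → EReal}
    (hsup : ∀ x : S, ∀ α : ℝ, f x < α → ∀ᶠ p : ℕ × S in atTop ×ˢ 𝓝 x, fseq p.1 p.2 ≤ α)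
    (hinf : ∀ x : S, ∀ α : EReal, α < f x → ∀ ε > 0,
      ∀ᶠ ν in atTop, ∃ y : S, dist y x < ε ∧ α ≤ fseq ν y) :
    HypoConverges fseq f := by
  refine ⟨fun x xseq hx => ?_, fun x => ?_⟩
  · refine EReal.le_of_forall_lt_iff_le.1 fun α hα => ?_
    exact limsup_le_of_le (h := (tendsto_id.prodMk hx).eventually (hsup x α hα))
  · rcases eq_or_ne (f x) ⊥ with hbot | hbot
    · exact ⟨fun _ => x, tendsto_const_nhds, by simp [hbot]⟩
    obtain ⟨α, -, hα, hαlim⟩ := exists_seq_strictMono_tendsto' (bot_lt_iff_ne_bot.2 hbot)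
    obtain ⟨m, hm, hev⟩ := exists_tendsto_eventually_diag fun m : ℕ =>
      hinf x (α m) (hα m).2 (1 / ((m : ℝ) + 1)) (by positivity)
    obtain ⟨N, hN⟩ := eventually_atTop.1 hev
    have : Nonempty S := ⟨x⟩
    choose! y hy using hN
    refine ⟨y, ?_, ?_⟩
    · refine tendsto_iff_dist_tendsto_zero.2 (squeeze_zero' (.of_forall fun _ => dist_nonneg)
        ?_ (tendsto_one_div_add_atTop_nhds_zero_nat.comp hm))
      filter_upwards [eventually_ge_atTop N] with ν hν using (hy ν hν).1.le
    · rw [← (hαlim.comp hm).liminf_eq]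
      refine liminf_le_liminf ?_
      filter_upwards [eventually_ge_atTop N] with ν hν using (hy ν hν).2

/-- An upper semicontinuous function is the hypo-limit of a sequence of maxima of cones, whose
peaks run through a dense sequence of its hypograph. -/
lemma exists_isDiffMaxAffine_seq {S : Set (Fin n → ℝ)} {f : S → EReal} (hf : f ∈ UscFcns S) :
    ∃ h : ℕ → (Fin n → ℝ) → ℝ, (∀ k, IsDiffMaxAffine (h k)) ∧
      (∀ x : S, ∀ α : ℝ, f x < α → ∀ᶠ p : ℕ × S in atTop ×ˢ 𝓝 x, h p.1 p.2 ≤ α) ∧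
      (∀ x : S, ∀ α : EReal, α < f x → ∀ ε > 0,
        ∀ᶠ k in atTop, ∃ y : S, dist y x < ε ∧ α ≤ (h k y : EReal)) := by
  obtain ⟨hne, hcl⟩ := hf
  have : Nonempty (hypo f) := hne.to_subtype
  obtain ⟨z, hz⟩ := TopologicalSpace.exists_dense_seq (hypo f)
  let y : ℕ → S := fun j => (z j).1.1
  let c : ℕ → ℝ := fun j => (z j).1.2
  have hc (j : ℕ) : (c j : EReal) ≤ f (y j) := (z j).2
  let C : ℕ → ℝ := fun k => ∑ j ∈ Finset.range (k + 1), |c j|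
  have hC (k : ℕ) : 0 ≤ C k := Finset.sum_nonneg fun _ _ => abs_nonneg _
  let K : ℕ → ℝ := fun k => k * (1 + C k)
  have hK (k : ℕ) : 0 ≤ K k := by have := hC k; positivity
  let φ : ℕ → ℕ → (Fin n → ℝ) → ℝ := fun k j x => c j - K k * ∑ i, |x i - (y j : Fin n → ℝ) i|
  refine ⟨fun k => (Finset.range (k + 1)).sup' Finset.nonempty_range_add_one (φ k),
    fun k => ?_, fun x α hα => ?_, fun x α hα ε hε => ?_⟩
  · exact Finset.sup'_induction _ _ (fun _ h₁ _ h₂ => h₁.sup h₂)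
      fun j _ => .cone _ _ _ (hK k)
  · have hnhds : ∀ᶠ w in 𝓝 x, f w < α := by
      have hmem : (hypo f)ᶜ ∈ 𝓝 (x, α) := hcl.isOpen_compl.mem_nhds (by simpa [hypo] using hα)
      have hcont : Tendsto (fun w : S => (w, α)) (𝓝 x) (𝓝 (x, α)) :=
        (Continuous.prodMk_left α).tendsto x
      filter_upwards [hcont hmem] with w hw
      simpa [hypo] using hw
    obtain ⟨δ, hδ, hball⟩ := Metric.eventually_nhds_iff.1 hnhds
    have hlarge : ∀ᶠ k : ℕ in atTop, 1 + |α| ≤ k * (δ / 2) :=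
      (tendsto_natCast_atTop_atTop.atTop_mul_const (half_pos hδ)).eventually_ge_atTop _
    filter_upwards [hlarge.prod_mk (Metric.ball_mem_nhds x (half_pos hδ))]
    rintro ⟨k, w⟩ ⟨hk, hw⟩
    simp only at hk hw ⊢
    rw [Finset.sup'_apply]
    refine Finset.sup'_le _ _ fun j hj => ?_
    have hsum : dist w (y j) ≤ ∑ i, |(w : Fin n → ℝ) i - (y j : Fin n → ℝ) i| := by
      rw [Subtype.dist_eq]
      refine (dist_pi_le_iff (Finset.sum_nonneg fun _ _ => abs_nonneg _)).2 fun i => ?_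
      rw [Real.dist_eq]
      exact Finset.single_le_sum
        (f := fun i => |(w : Fin n → ℝ) i - (y j : Fin n → ℝ) i|)
        (fun _ _ => abs_nonneg _) (Finset.mem_univ i)
    have hφ : φ k j w ≤ c j - K k * dist w (y j) :=
      sub_le_sub_left (mul_le_mul_of_nonneg_left hsum (hK k)) _
    refine hφ.trans ?_
    rcases lt_or_ge (dist w (y j)) (δ / 2) with hnear | hfar
    · have hyx : dist (y j) x < δ := by
        have := dist_triangle_left (y j) x w
        have := Metric.mem_ball.1 hw
        linarith
      have hcα : c j < α := EReal.coe_lt_coe_iff.1 ((hc j).trans_lt (hball hyx))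
      have := mul_nonneg (hK k) (dist_nonneg (x := w) (y := y j))
      linarith
    · have hcC : c j ≤ C k := (le_abs_self _).trans
        (Finset.single_le_sum (f := fun j => |c j|) (fun _ _ => abs_nonneg _) hj)
      have h₁ : K k * (δ / 2) ≤ K k * dist w (y j) := mul_le_mul_of_nonneg_left hfar (hK k)
      have h₂ : (1 + |α|) * (1 + C k) ≤ K k * (δ / 2) := by
        calc (1 + |α|) * (1 + C k) ≤ (k * (δ / 2)) * (1 + C k) :=
              mul_le_mul_of_nonneg_right hk (by linarith [hC k])
          _ = K k * (δ / 2) := by simp only [K]; ring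
      have := mul_nonneg (abs_nonneg α) (hC k)
      have := neg_abs_le α
      nlinarith
  · obtain ⟨a, hαa, haf⟩ := EReal.lt_iff_exists_real_btwn.1 hα
    let U : Set (hypo f) := {p | dist p.1.1 x < ε ∧ α < (p.1.2 : EReal)}
    have hU : IsOpen U := by
      have h₁ : Continuous fun p : hypo f => dist p.1.1 x := by fun_prop
      have h₂ : Continuous fun p : hypo f => (p.1.2 : EReal) :=
        continuous_coe_real_ereal.comp (by fun_prop)
      exact (isOpen_lt h₁ continuous_const).inter (isOpen_lt continuous_const h₂)
    obtain ⟨j, hj⟩ := hz.exists_mem_open hU ⟨⟨(x, a), haf.le⟩, by simpa [U] using ⟨hε, hαa⟩⟩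
    filter_upwards [eventually_ge_atTop j] with k hk
    refine ⟨y j, hj.1, hj.2.le.trans (EReal.coe_le_coe_iff.2 ?_)⟩
    rw [Finset.sup'_apply]
    refine le_trans ?_ (Finset.le_sup' (fun j' => φ k j' (y j))
      (Finset.mem_range.2 (Nat.lt_succ_of_le hk)))
    simp [φ, c]

/-- Theorem 3.1 (piecewise affine approximations): if `S` is nonempty, closed, convex and
contains the origin, and `ρ^ν ∈ [0,∞)`, `q^ν ∈ ℕ` tend to `∞`, then
`⋃_ν pa-fcns^{q^ν}_{ρ^ν}(S)` is hypo-dense in `usc-fcns(S)`. -/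
theorem piecewise_affine_approximation
    {n : ℕ} {S : Set (Fin n → ℝ)} (hSne : S.Nonempty) (hScl : IsClosed S)
    (hScv : Convex ℝ S) (hS0 : (0 : Fin n → ℝ) ∈ S)
    (ρ : ℕ → ℝ) (hρ0 : ∀ ν, 0 ≤ ρ ν) (hρ : Tendsto ρ atTop atTop)
    (q : ℕ → ℕ) (hq1 : ∀ ν, 1 ≤ q ν) (hq : Tendsto q atTop atTop)
    (f : S → EReal) (hf : f ∈ UscFcns S) :
    ∃ fseq : ℕ → S → EReal, (∀ ν, fseq ν ∈ PaFcns S (q ν) (ρ ν)) ∧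
      HypoConverges fseq f := by
  obtain ⟨h, hdc, hsup, hinf⟩ := exists_isDiffMaxAffine_seq hf
  choose Q hQ using fun k => (hdc k).exists_mem_paFcns S
  obtain ⟨k, hk, hQk⟩ := exists_tendsto_eventually_diag fun m => hq.eventually_ge_atTop (Q m)
  let g : ℕ → (Fin n → ℝ) → EReal := fun ν x => if Q (k ν) ≤ q ν then (h (k ν) x : EReal) else 0
  refine ⟨fun ν x => if ‖(x : Fin n → ℝ)‖ ≤ ρ ν then g ν x else ⊥, fun ν => ?_,
    hypoConverges_of_eventually (fun x α hα => ?_) (fun x α hα ε hε => ?_)⟩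
  · by_cases hν : Q (k ν) ≤ q ν
    · simpa only [g, hν, if_true] using hQ (k ν) (q ν) hν (ρ ν)
    · simpa only [g, hν, if_false] using const_mem_paFcns S (hq1 ν) (ρ ν)
  · filter_upwards [(hk.prodMap tendsto_id).eventually (hsup x α hα), hQk.prod_inl (𝓝 x)]
      with p hp hQp
    simp only [g, hQp, if_true]
    split_ifs
    · exact EReal.coe_le_coe_iff.2 hp
    · exact bot_le
  · filter_upwards [hk.eventually (hinf x α hα ε hε), hQk,
      hρ.eventually_ge_atTop (‖(x : Fin n → ℝ)‖ + ε)] with ν ⟨y, hyx, hy⟩ hQν hρν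
    have hynorm : ‖(y : Fin n → ℝ)‖ ≤ ρ ν := by
      have h₁ := norm_le_norm_add_norm_sub' (y : Fin n → ℝ) (x : Fin n → ℝ)
      rw [← dist_eq_norm, ← Subtype.dist_eq] at h₁
      linarith
    exact ⟨y, hyx, by simpa only [g, hynorm, hQν, if_true] using hy⟩

end
end

section
/- Let S ⊂ ℝⁿ be a nonempty closed convex set containing the origin and ρ ≥ 0. Let g, h : S → [−∞,∞] be finite on S ∩ ρB_∞ (where ρB_∞ = {x ∈ S : ‖x‖_∞ ≤ ρ}) with g continuous on S ∩ ρB_∞. Suppose g̃_μ, h̃_μ : S → [−∞,∞] (μ ∈ ℕ) satisfy: g̃_μ(x) ≤ g(x) for all x ∈ S ∩ ρB_∞ and μ; liminf_μ h̃_μ(x^μ) ≥ h(x) for every x ∈ S and every sequence x^μ ∈ S ∩ ρB_∞ with x^μ → x; and g̃_μ(x) → g(x) and h̃_μ(x) → h(x) for every x ∈ S ∩ ρB_∞. Define ψ : S → [−∞,∞] by ψ(x) = g(x) − h(x) for x ∈ S ∩ ρB_∞ and ψ(x) = −∞ otherwise, and ψ̃_μ : S → [−∞,∞] by ψ̃_μ(x)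 = g̃_μ(x) − h̃_μ(x) for x ∈ S ∩ ρB_∞ and ψ̃_μ(x) = −∞ otherwise. Then ψ̃_μ hypo-converges to ψ as μ → ∞. -/
open Filter Topology MeasureTheory Metric Set
open scoped Classical ENNReal NNReal

noncomputable section

variable {n : ℕ}

/-- Hypo-convergence of the difference-of-max approximations `ψ̃_μ` to `ψ` (the final step in
the proof of Theorem 3.1). -/
theorem hypo_convergence_of_difference_approximations
    {n : ℕ} {S : Set (Fin n → ℝ)} (hSne : S.Nonempty) (hScl : IsClosed S)
    (hScv : Convex ℝ S) (hS0 : (0 : Fin n → ℝ) ∈ S)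
    (ρ : ℝ) (hρ : 0 ≤ ρ)
    (g h : S → EReal)
    (hfin : ∀ x : S, ‖(x : Fin n → ℝ)‖ ≤ ρ →
      g x ≠ ⊤ ∧ g x ≠ ⊥ ∧ h x ≠ ⊤ ∧ h x ≠ ⊥)
    (hgcont : ∀ x : S, ‖(x : Fin n → ℝ)‖ ≤ ρ → ∀ xseq : ℕ → S,
      (∀ μ, ‖(xseq μ : Fin n → ℝ)‖ ≤ ρ) → Tendsto xseq atTop (𝓝 x) →
      Tendsto (fun μ => g (xseq μ)) atTop (𝓝 (g x)))
    (gt ht : ℕ → S → EReal)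
    (hle : ∀ (μ : ℕ) (x : S), ‖(x : Fin n → ℝ)‖ ≤ ρ → gt μ x ≤ g x)
    (hliminf : ∀ (x : S) (xseq : ℕ → S), (∀ μ, ‖(xseq μ : Fin n → ℝ)‖ ≤ ρ) →
      Tendsto xseq atTop (𝓝 x) → h x ≤ Filter.liminf (fun μ => ht μ (xseq μ)) atTop)
    (hptg : ∀ x : S, ‖(x : Fin n → ℝ)‖ ≤ ρ →
      Tendsto (fun μ => gt μ x) atTop (𝓝 (g x)))
    (hpth : ∀ x : S, ‖(x : Fin n → ℝ)‖ ≤ ρ →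
      Tendsto (fun μ => ht μ x) atTop (𝓝 (h x)))
    (ψ : S → EReal)
    (hψ : ∀ x : S, (‖(x : Fin n → ℝ)‖ ≤ ρ → ψ x = g x - h x) ∧
      (¬ ‖(x : Fin n → ℝ)‖ ≤ ρ → ψ x = ⊥))
    (ψt : ℕ → S → EReal)
    (hψt : ∀ (μ : ℕ) (x : S), (‖(x : Fin n → ℝ)‖ ≤ ρ → ψt μ x = gt μ x - ht μ x) ∧
      (¬ ‖(x : Fin n → ℝ)‖ ≤ ρ → ψt μ x = ⊥)) :
    HypoConverges ψt ψ := by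
  constructor
  · intro x xseq hx
    by_cases hxρ : ‖(x : Fin n → ℝ)‖ ≤ ρ
    · obtain ⟨hg_top, hg_bot, -, -⟩ := hfin x hxρ
      let y : ℕ → S := fun μ => if ‖(xseq μ : Fin n → ℝ)‖ ≤ ρ then xseq μ else x
      have hyρ : ∀ μ, ‖(y μ : Fin n → ℝ)‖ ≤ ρ := by
        intro μ
        by_cases hμ : ‖(xseq μ : Fin n → ℝ)‖ ≤ ρ
        · simpa only [y, if_pos hμ] using hμ
        · simpa only [y, if_neg hμ] using hxρ
      have hy : Tendsto y atTop (𝓝 x) :=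
        hx.if' tendsto_const_nhds
      have hψy : ∀ μ, ψt μ (xseq μ) ≤ g (y μ) + -ht μ (y μ) := by
        intro μ
        by_cases hμ : ‖(xseq μ : Fin n → ℝ)‖ ≤ ρ
        · have hyμ : y μ = xseq μ := if_pos hμ
          rw [hyμ, (hψt μ _).1 hμ, sub_eq_add_neg]
          gcongr
          exact hle μ _ hμ
        · rw [(hψt μ _).2 hμ]
          exact bot_le
      have hglim : limsup (fun μ => g (y μ)) atTop = g x := (hgcont x hxρ y hyρ hy).limsup_eq
      have hhlim : limsup (fun μ => -ht μ (y μ)) atTop ≤ -h x := by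
        have hneg : limsup (fun μ => -ht μ (y μ)) atTop = -liminf (fun μ => ht μ (y μ)) atTop :=
          EReal.limsup_neg
        rw [hneg]
        exact EReal.neg_le_neg_iff.2 (hliminf x y hyρ hy)
      calc limsup (fun μ => ψt μ (xseq μ)) atTop
          ≤ limsup (fun μ => g (y μ) + -ht μ (y μ)) atTop :=
            limsup_le_limsup (Eventually.of_forall hψy)
        _ ≤ limsup (fun μ => g (y μ)) atTop + limsup (fun μ => -ht μ (y μ)) atTop :=
            EReal.limsup_add_le (Or.inl (hglim ▸ hg_bot)) (Or.inl (hglim ▸ hg_top))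
        _ ≤ g x + -h x := by
            rw [hglim]
            gcongr
        _ = ψ x := by rw [(hψ x).1 hxρ, sub_eq_add_neg]
    · have hnorm : Tendsto (fun μ => ‖(xseq μ : Fin n → ℝ)‖) atTop (𝓝 ‖(x : Fin n → ℝ)‖) :=
        ((continuous_subtype_val.tendsto x).comp hx).norm
      have hbot : ∀ᶠ μ in atTop, ψt μ (xseq μ) ≤ ψ x := by
        filter_upwards [hnorm.eventually_const_lt (not_le.1 hxρ)] with μ hμ
        rw [(hψt μ _).2 (not_le.2 hμ)]
        exact bot_le
      exact limsup_le_of_le (h := hbot)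
  · intro x
    refine ⟨fun _ => x, tendsto_const_nhds, ?_⟩
    by_cases hxρ : ‖(x : Fin n → ℝ)‖ ≤ ρ
    · obtain ⟨hg_top, hg_bot, -, -⟩ := hfin x hxρ
      have hlim : Tendsto (fun μ => ψt μ x) atTop (𝓝 (ψ x)) := by
        simp only [fun μ => (hψt μ x).1 hxρ, (hψ x).1 hxρ, sub_eq_add_neg]
        exact (EReal.continuousAt_add (p := (g x, -h x)) (Or.inl hg_top) (Or.inl hg_bot)).tendsto.comp
          ((hptg x hxρ).prodMk_nhds ((continuous_neg.tendsto (h x)).comp (hpth x hxρ)))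
      exact hlim.liminf_eq.ge
    · rw [(hψ x).2 hxρ]
      exact bot_le

end
end

section
/- For every n ∈ ℕ there exist a bounded subset F ⊂ usc-fcns(ℝⁿ) and corresponding c > 0 and ε̄ > 0 (independent of n) such that log N(F, ε) ≥ (c/ε)^n log(1/ε) for all ε ∈ (0, ε̄]. -/
open Filter Topology MeasureTheory Metric Set
open scoped Classical ENNReal NNReal

noncomputable section

variable {n : ℕ}

section AttouchWets

variable {S : Set (Fin n → ℝ)}

theorem abs_infDist_sub_infDist_sub_le {α : Type*} [PseudoMetricSpace α] (A B : Set α) (x y : α) :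
    |infDist x A - infDist x B| ≤ |infDist y A - infDist y B| + 2 * dist x y := by
  have h1 := infDist_le_infDist_add_dist (s := A) (x := x) (y := y)
  have h2 := infDist_le_infDist_add_dist (s := A) (x := y) (y := x)
  have h3 := infDist_le_infDist_add_dist (s := B) (x := x) (y := y)
  have h4 := infDist_le_infDist_add_dist (s := B) (x := y) (y := x)
  rw [dist_comm y x] at h2 h4
  have h5 := neg_abs_le (infDist y A - infDist y B)
  have h6 := le_abs_self (infDist y A - infDist y B)
  rw [abs_le]
  constructor <;> linarith

theorem dist_origin_le {h0 : (0 : Fin n → ℝ) ∈ S} {z : S × ℝ} {ρ : ℝ}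
    (h1 : ‖(z.1 : Fin n → ℝ)‖ ≤ ρ) (h2 : |z.2| ≤ ρ) :
    dist z ((⟨0, h0⟩ : S), (0 : ℝ)) ≤ ρ := by
  rw [Prod.dist_eq, Subtype.dist_eq]
  simpa using ⟨h1, h2⟩

theorem abs_infDist_hypo_sub_le (h0 : (0 : Fin n → ℝ) ∈ S) (f g : S → EReal) {z : S × ℝ} {ρ : ℝ}
    (h1 : ‖(z.1 : Fin n → ℝ)‖ ≤ ρ) (h2 : |z.2| ≤ ρ) :
    |infDist z (hypo f) - infDist z (hypo g)| ≤
      |infDist ((⟨0, h0⟩ : S), (0 : ℝ)) (hypo f) - infDist ((⟨0, h0⟩ : S), (0 : ℝ)) (hypo g)|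
        + 2 * ρ := by
  have := abs_infDist_sub_infDist_sub_le (hypo f) (hypo g) z ((⟨0, h0⟩ : S), (0 : ℝ))
  have := dist_origin_le (h0 := h0) h1 h2
  linarith

theorem bddAbove_awDistRho (h0 : (0 : Fin n → ℝ) ∈ S) (f g : S → EReal) (ρ : ℝ) :
    BddAbove ((fun z : S × ℝ => |infDist z (hypo f) - infDist z (hypo g)|) ''
      {z : S × ℝ | ‖(z.1 : Fin n → ℝ)‖ ≤ ρ ∧ |z.2| ≤ ρ}) := by
  refine ⟨|infDist ((⟨0, h0⟩ : S), (0 : ℝ)) (hypo f) -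
    infDist ((⟨0, h0⟩ : S), (0 : ℝ)) (hypo g)| + 2 * ρ, ?_⟩
  rintro _ ⟨z, ⟨h1, h2⟩, rfl⟩
  exact abs_infDist_hypo_sub_le h0 f g h1 h2

theorem awDistRho_nonneg (f g : S → EReal) (ρ : ℝ) : 0 ≤ awDistRho f g ρ := by
  apply Real.sSup_nonneg
  rintro _ ⟨z, -, rfl⟩
  exact abs_nonneg _

theorem abs_infDist_sub_le_awDistRho (h0 : (0 : Fin n → ℝ) ∈ S) (f g : S → EReal) {z : S × ℝ}
    {ρ : ℝ} (h1 : ‖(z.1 : Fin n → ℝ)‖ ≤ ρ) (h2 : |z.2| ≤ ρ) :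
    |infDist z (hypo f) - infDist z (hypo g)| ≤ awDistRho f g ρ :=
  le_csSup (bddAbove_awDistRho h0 f g ρ) ⟨z, ⟨h1, h2⟩, rfl⟩

theorem awDistRho_mono (h0 : (0 : Fin n → ℝ) ∈ S) (f g : S → EReal) :
    Monotone (awDistRho f g) := by
  intro ρ ρ' h
  refine Real.sSup_le ?_ (awDistRho_nonneg f g ρ')
  rintro _ ⟨z, ⟨h1, h2⟩, rfl⟩
  exact abs_infDist_sub_le_awDistRho h0 f g (h1.trans h) (h2.trans h)

theorem awDistRho_le (h0 : (0 : Fin n → ℝ) ∈ S) (f g : S → EReal) {ρ : ℝ} (hρ : 0 ≤ ρ) :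
    awDistRho f g ρ ≤
      |infDist ((⟨0, h0⟩ : S), (0 : ℝ)) (hypo f) - infDist ((⟨0, h0⟩ : S), (0 : ℝ)) (hypo g)|
        + 2 * ρ := by
  refine Real.sSup_le ?_ (by positivity)
  rintro _ ⟨z, ⟨h1, h2⟩, rfl⟩
  exact abs_infDist_hypo_sub_le h0 f g h1 h2

theorem integrableOn_affine_mul_exp_neg (C : ℝ) :
    IntegrableOn (fun ρ : ℝ => (C + 2 * ρ) * Real.exp (-ρ)) (Ioi 0) := by
  have h1 : IntegrableOn (fun ρ : ℝ => Real.exp (-ρ)) (Ioi 0) := integrableOn_exp_neg_Ioi 0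
  have h2 : IntegrableOn (fun ρ : ℝ => Real.exp (-ρ) * ρ ^ ((2 : ℝ) - 1)) (Ioi 0) :=
    Real.GammaIntegral_convergent (by norm_num)
  refine IntegrableOn.congr_fun ((h1.const_mul C).add (h2.const_mul 2)) (fun ρ _ => ?_) measurableSet_Ioi
  have : (2 : ℝ) - 1 = 1 := by norm_num
  simp only [Pi.add_apply, this, Real.rpow_one]
  ring

theorem integrableOn_awDistRho (h0 : (0 : Fin n → ℝ) ∈ S) (f g : S → EReal) :
    IntegrableOn (fun ρ => awDistRho f g ρ * Real.exp (-ρ)) (Ioi 0) := by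
  refine Integrable.mono' (integrableOn_affine_mul_exp_neg
    |infDist ((⟨0, h0⟩ : S), (0 : ℝ)) (hypo f) - infDist ((⟨0, h0⟩ : S), (0 : ℝ)) (hypo g)|) ?_ ?_
  · exact ((awDistRho_mono h0 f g).measurable.mul (by fun_prop)).aestronglyMeasurable
  · refine (ae_restrict_iff' measurableSet_Ioi).2 (Eventually.of_forall fun ρ hρ => ?_)
    rw [Real.norm_of_nonneg (mul_nonneg (awDistRho_nonneg f g ρ) (Real.exp_pos _).le)]
    exact mul_le_mul_of_nonneg_right (awDistRho_le h0 f g (le_of_lt hρ)) (Real.exp_pos _).le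

theorem abs_infDist_sub_mul_exp_le_awDist (h0 : (0 : Fin n → ℝ) ∈ S) (f g : S → EReal)
    {z : S × ℝ} {r : ℝ} (hr : 0 ≤ r) (h1 : ‖(z.1 : Fin n → ℝ)‖ ≤ r) (h2 : |z.2| ≤ r) :
    |infDist z (hypo f) - infDist z (hypo g)| * Real.exp (-r) ≤ awDist f g := by
  have hI := integrableOn_awDistRho h0 f g
  have hsub : Ioi r ⊆ Ioi 0 := Ioi_subset_Ioi hr
  calc |infDist z (hypo f) - infDist z (hypo g)| * Real.exp (-r)
      = ∫ ρ in Ioi r, |infDist z (hypo f) - infDist z (hypo g)| * Real.exp (-ρ) := by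
        rw [integral_const_mul, integral_exp_neg_Ioi]
    _ ≤ ∫ ρ in Ioi r, awDistRho f g ρ * Real.exp (-ρ) := by
        refine setIntegral_mono_on ((integrableOn_exp_neg_Ioi r).const_mul _)
          (hI.mono_set hsub) measurableSet_Ioi fun ρ hρ => ?_
        have hρ' : r ≤ ρ := le_of_lt hρ
        exact mul_le_mul_of_nonneg_right
          (abs_infDist_sub_le_awDistRho h0 f g (h1.trans hρ') (h2.trans hρ')) (Real.exp_pos _).le
    _ ≤ awDist f g := by
        refine setIntegral_mono_set hI (Eventually.of_forall fun ρ => ?_) hsub.eventuallyLE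
        exact mul_nonneg (awDistRho_nonneg f g ρ) (Real.exp_pos _).le

theorem awBounded_of_origin_mem (h0 : (0 : Fin n → ℝ) ∈ S) {F : Set (S → EReal)}
    (hF : ∀ f ∈ F, ((⟨0, h0⟩ : S), (0 : ℝ)) ∈ hypo f) : AwBounded F := by
  refine ⟨fun _ => ⊤, ∫ ρ in Ioi (0 : ℝ), (0 + 2 * ρ) * Real.exp (-ρ), fun f hf => ?_⟩
  refine setIntegral_mono_on (integrableOn_awDistRho h0 _ f) (integrableOn_affine_mul_exp_neg 0)
    measurableSet_Ioi fun ρ hρ => mul_le_mul_of_nonneg_right ?_ (Real.exp_pos _).le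
  have h := awDistRho_le h0 (fun _ => ⊤) f (le_of_lt hρ)
  rwa [infDist_zero_of_mem (hF f hf), infDist_zero_of_mem (by simp [hypo]), sub_zero,
    abs_zero] at h

end AttouchWets

section Grid

variable {N : ℕ}

/-- The grid point of mesh `s` with index `k`, as an element of the whole space. -/
def gridPoint (s : ℝ) (k : Fin n → Fin N) : ↥(univ : Set (Fin n → ℝ)) :=
  ⟨fun i => s * (k i : ℕ), mem_univ _⟩

/-- The function with value `s * v k` at the grid point `k` and `⊥` off the grid. -/
def gridFun (s : ℝ) (v : (Fin n → Fin N) → Fin N) : ↥(univ : Set (Fin n → ℝ)) → EReal :=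
  fun x => Finset.univ.sup fun k => if x = gridPoint s k then ((s * (v k : ℕ) : ℝ) : EReal) else ⊥

theorem mem_hypo_gridFun {s : ℝ} {v : (Fin n → Fin N) → Fin N}
    {p : ↥(univ : Set (Fin n → ℝ)) × ℝ} :
    p ∈ hypo (gridFun s v) ↔ ∃ k, p.1 = gridPoint s k ∧ p.2 ≤ s * (v k : ℕ) := by
  simp only [hypo, gridFun, mem_ofPred_eq, Finset.le_sup_iff (EReal.bot_lt_coe p.2),
    Finset.mem_univ, true_and]
  refine exists_congr fun k => ?_
  split_ifs with h
  · rw [EReal.coe_le_coe_iff]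
    exact ⟨fun h' => ⟨h, h'⟩, And.right⟩
  · simp [h]

theorem isClosed_hypo_gridFun (s : ℝ) (v : (Fin n → Fin N) → Fin N) :
    IsClosed (hypo (gridFun s v)) := by
  have : hypo (gridFun s v) =
      ⋃ k, {p : ↥(univ : Set (Fin n → ℝ)) × ℝ | p.1 = gridPoint s k ∧ p.2 ≤ s * (v k : ℕ)} := by
    ext p
    simp only [mem_hypo_gridFun, mem_iUnion, mem_ofPred_eq]
  rw [this]
  exact isClosed_iUnion_of_finite fun k =>
    (isClosed_eq continuous_fst continuous_const).inter
      (isClosed_le continuous_snd continuous_const)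

theorem origin_mem_hypo_gridFun {K : ℕ} {s : ℝ} (hs : 0 ≤ s)
    (v : (Fin n → Fin (K + 1)) → Fin (K + 1)) :
    ((⟨0, mem_univ _⟩ : ↥(univ : Set (Fin n → ℝ))), (0 : ℝ)) ∈ hypo (gridFun s v) := by
  refine mem_hypo_gridFun.2 ⟨fun _ => 0, ?_, by positivity⟩
  ext i
  simp [gridPoint]

theorem mul_le_dist_of_ne {s : ℝ} (hs : 0 ≤ s) {a b : ℕ} (h : a ≠ b) :
    s ≤ |s * a - s * b| := by
  rw [← mul_sub, abs_mul, abs_of_nonneg hs]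
  refine le_mul_of_one_le_right hs ?_
  have : (1 : ℤ) ≤ |(a : ℤ) - b| := Int.one_le_abs (by omega)
  exact_mod_cast this

theorem le_infDist_hypo_gridFun {s : ℝ} (hs : 0 ≤ s) {v : (Fin n → Fin N) → Fin N}
    (hne : (hypo (gridFun s v)).Nonempty) {k : Fin n → Fin N} {j : ℕ} (hj : (v k : ℕ) < j) :
    s ≤ infDist (gridPoint s k, s * (j : ℝ)) (hypo (gridFun s v)) := by
  rw [le_infDist hne]
  intro p hp
  obtain ⟨k', h1, h2⟩ := mem_hypo_gridFun.1 hp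
  rw [Prod.dist_eq]
  by_cases hk : k = k'
  · subst hk
    refine le_max_of_le_right ?_
    rw [Real.dist_eq]
    refine le_trans ?_ (le_abs_self _)
    have : ((v k : ℕ) : ℝ) + 1 ≤ j := by exact_mod_cast hj
    have := mul_le_mul_of_nonneg_left this hs
    dsimp only
    linarith
  · obtain ⟨i, hi⟩ := Function.ne_iff.1 hk
    refine le_max_of_le_left ?_
    rw [h1, Subtype.dist_eq]
    refine le_trans ?_ (dist_le_pi_dist _ _ i)
    rw [Real.dist_eq]
    exact mul_le_dist_of_ne hs fun h => hi (Fin.ext h)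

theorem mesh_mul_exp_le_of_lt {K : ℕ} {s : ℝ} (hs : 0 ≤ s) (hK : s * K ≤ 1)
    {v w : (Fin n → Fin (K + 1)) → Fin (K + 1)} {k : Fin n → Fin (K + 1)} (h : w k < v k)
    (f : ↥(univ : Set (Fin n → ℝ)) → EReal) :
    s * Real.exp (-1) ≤ awDist f (gridFun s v) + awDist f (gridFun s w) := by
  have hle : ∀ a : Fin (K + 1), |s * ((a : ℕ) : ℝ)| ≤ 1 := fun a => by
    rw [abs_of_nonneg (by positivity)]
    refine le_trans (mul_le_mul_of_nonneg_left ?_ hs) hK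
    exact_mod_cast Nat.le_of_lt_succ a.2
  set z : ↥(univ : Set (Fin n → ℝ)) × ℝ := (gridPoint s k, s * ((v k : ℕ) : ℝ)) with hz
  have h1 : ‖(z.1 : Fin n → ℝ)‖ ≤ 1 :=
    (pi_norm_le_iff_of_nonneg zero_le_one).2 fun i => hle (k i)
  have hv := abs_infDist_sub_mul_exp_le_awDist (mem_univ _) f (gridFun s v) zero_le_one h1
    (hle (v k))
  have hw := abs_infDist_sub_mul_exp_le_awDist (mem_univ _) f (gridFun s w) zero_le_one h1
    (hle (v k))
  have hv0 : infDist z (hypo (gridFun s v)) = 0 :=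
    infDist_zero_of_mem (mem_hypo_gridFun.2 ⟨k, rfl, le_rfl⟩)
  have hws : s ≤ infDist z (hypo (gridFun s w)) :=
    le_infDist_hypo_gridFun hs ⟨_, origin_mem_hypo_gridFun hs w⟩ h
  refine le_trans ?_ (add_le_add hv hw)
  rw [← add_mul]
  refine mul_le_mul_of_nonneg_right ?_ (Real.exp_pos _).le
  rw [hv0]
  have h3 := le_abs_self (infDist z (hypo f) - 0)
  have h4 := neg_abs_le (infDist z (hypo f) - infDist z (hypo (gridFun s w)))
  linarith

theorem mesh_mul_exp_le_of_ne {K : ℕ} {s : ℝ} (hs : 0 ≤ s) (hK : s * K ≤ 1)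
    {v w : (Fin n → Fin (K + 1)) → Fin (K + 1)} (h : v ≠ w)
    (f : ↥(univ : Set (Fin n → ℝ)) → EReal) :
    s * Real.exp (-1) ≤ awDist f (gridFun s v) + awDist f (gridFun s w) := by
  obtain ⟨k, hk⟩ := Function.ne_iff.1 h
  rcases lt_or_gt_of_ne hk with hk | hk
  · rw [add_comm]
    exact mesh_mul_exp_le_of_lt hs hK hk f
  · exact mesh_mul_exp_le_of_lt hs hK hk f

end Grid

theorem two_mul_lt_six_mul_exp_neg_one {ε : ℝ} (hε : 0 < ε) :
    ε + ε < 6 * ε * Real.exp (-1) := by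
  rw [Real.exp_neg, ← div_eq_mul_inv, lt_div_iff₀ (Real.exp_pos 1)]
  have := Real.exp_one_lt_d9
  nlinarith

theorem rate_le_log_pow_pow {ε : ℝ} (hε : 0 < ε) (hε' : ε ≤ 1 / 36) (hn : 0 < n) {M : ℕ}
    (hM : 1 / (6 * ε) ≤ M) :
    (1 / 12 / ε) ^ n * Real.log (1 / ε) ≤ Real.log ((M ^ M ^ n : ℕ) : ℝ) := by
  have hpos : 0 < 1 / (6 * ε) := by positivity
  have hlog : Real.log (1 / ε) ≤ 2 * Real.log M := by
    have h1 : Real.log (1 / ε) ≤ Real.log ((1 / (6 * ε)) ^ 2) := by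
      refine Real.log_le_log (by positivity) ?_
      rw [div_pow, div_le_div_iff₀ hε (by positivity)]
      nlinarith
    rw [Real.log_pow] at h1
    have h2 := Real.log_le_log hpos hM
    push_cast at h1
    linarith
  have hhalf : (1 / 2 : ℝ) ^ n ≤ 1 / 2 := pow_le_of_le_one (by norm_num) (by norm_num) hn.ne'
  have hpow : (1 / (6 * ε)) ^ n ≤ (M : ℝ) ^ n := pow_le_pow_left₀ hpos.le hM n
  have hM1 : (1 : ℝ) ≤ M := by
    refine le_trans ?_ hM
    rw [le_div_iff₀ (by positivity)]
    linarith
  have heq : 1 / 12 / ε = 1 / 2 * (1 / (6 * ε)) := by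
    field_simp
    norm_num
  push_cast
  rw [Real.log_pow, heq, mul_pow]
  push_cast
  calc (1 / 2 : ℝ) ^ n * (1 / (6 * ε)) ^ n * Real.log (1 / ε)
      ≤ 1 / 2 * (M : ℝ) ^ n * (2 * Real.log M) := by
        refine mul_le_mul (mul_le_mul hhalf hpow (by positivity) (by norm_num)) hlog
          (Real.log_nonneg ?_) (by positivity)
        rw [le_div_iff₀ hε]
        linarith
    _ = (M : ℝ) ^ n * Real.log M := by ring

/-- Theorem 4.4 (covering numbers; lower bound): for every `n` there is a bounded set
`F ⊂ usc-fcns(ℝⁿ)` with `log N(F,ε) ≥ (c/ε)^n log(1/ε)` for all small `ε`, where `c, ε̄ > 0`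
do not depend on `n`. -/
theorem covering_number_lower_bound :
    ∃ c : ℝ, 0 < c ∧ ∃ εbar : ℝ, 0 < εbar ∧
      ∀ n : ℕ, 0 < n → ∀ S : Set (Fin n → ℝ), S = Set.univ →
        ∃ F : Set (S → EReal),
          F ⊆ UscFcns S ∧ AwBounded F ∧
          ∀ ε : ℝ, 0 < ε → ε ≤ εbar →
            ∀ (m : ℕ) (ctr : Fin m → (S → EReal)),
              (∀ f ∈ F, ∃ i, awDist (ctr i) f ≤ ε) →
              (c / ε) ^ n * Real.log (1 / ε) ≤ Real.log m := by
  refine ⟨1 / 12, by norm_num, 1 / 36, by norm_num, ?_⟩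
  rintro n hn S rfl
  refine ⟨{f | f ∈ UscFcns univ ∧ ((⟨0, mem_univ _⟩ : ↥(univ : Set (Fin n → ℝ))), (0 : ℝ)) ∈ hypo f},
    fun f hf => hf.1, awBounded_of_origin_mem (mem_univ _) fun f hf => hf.2, ?_⟩
  intro ε hε hε' m ctr hcov
  set K := ⌊1 / (6 * ε)⌋₊
  have hs : 0 ≤ 6 * ε := by positivity
  have hK : 6 * ε * K ≤ 1 := by
    have : (K : ℝ) ≤ 1 / (6 * ε) := Nat.floor_le (by positivity)
    rwa [le_div_iff₀ (by positivity), mul_comm] at this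
  have hcov' : ∀ v : (Fin n → Fin (K + 1)) → Fin (K + 1),
      ∃ i, awDist (ctr i) (gridFun (6 * ε) v) ≤ ε := fun v =>
    hcov _ ⟨⟨⟨_, origin_mem_hypo_gridFun hs v⟩, isClosed_hypo_gridFun _ v⟩,
      origin_mem_hypo_gridFun hs v⟩
  choose φ hφ using hcov'
  have hinj : Function.Injective φ := by
    intro v w hvw
    by_contra hne
    have h1 := mesh_mul_exp_le_of_ne hs hK hne (ctr (φ v))
    have h2 := hφ v
    have h3 := hφ w
    rw [← hvw] at h3
    linarith [two_mul_lt_six_mul_exp_neg_one hε]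
  have hcard : (K + 1) ^ (K + 1) ^ n ≤ m := by
    simpa using Fintype.card_le_of_injective φ hinj
  have hM : 1 / (6 * ε) ≤ ((K + 1 : ℕ) : ℝ) := by
    push_cast
    exact (Nat.lt_floor_add_one _).le
  refine (rate_le_log_pow_pow hε hε' hn hM).trans (Real.log_le_log ?_ ?_)
  · exact_mod_cast pow_pos K.succ_pos _
  · exact_mod_cast hcard

end
end
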